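/- arXiv:1806.11204 — 3 statements merged into one kernel-verified Lean document; each statement's English description precedes it below -/
import Mathlib

section
/- Let g_1, …, g_r, h_1, …, h_s, and p_1, …, p_t be polynomials in ℝ[x_1, …, x_n] and let γ_1, …, γ_t ∈ ℝ. Suppose there exist sums of squares σ_0, σ_1, …, σ_r, polynomials u_1, …, u_s, and nonnegative reals λ_1, …, λ_t such that σ_0 + Σ_{j=1}^r σ_j·g_j + Σ_{k=1}^s u_k·h_k + Σ_{ℓ=1}^t λ_ℓ·(γ_ℓ - p_ℓ) = -1 as polynomials. Then there is no probability measure μ on ℝ^n such that: μ-almost every x satisfies g_j(x) ≥ 0 for all j and h_k(x) = 0 for all k; each of the polynomial functions σ_0, σ_j·g_j, u_k·h_k, and p_ℓ is μ-integrable; and ∫ p_ℓ dμ ≤ γ_ℓ for all ℓ = 1, …, t. -/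
open MvPolynomial MeasureTheory

/-- **Soundness of extended sum-of-squares refutations with moment constraints.**
If `σ0 + Σ_j σ_j g_j + Σ_k u_k h_k + Σ_ℓ λ_ℓ (γ_ℓ - p_ℓ) = -1` with the `σ`'s sums of
squares and `λ_ℓ ≥ 0`, then no probability measure is supported on the set
`{x : g_j(x) ≥ 0 ∀j, h_k(x) = 0 ∀k}`, makes all the relevant polynomial functions
integrable, and satisfies the moment bounds `∫ p_ℓ dμ ≤ γ_ℓ`. -/
theorem stmt_1 (n r s t : ℕ)
    (g : Fin r → MvPolynomial (Fin n) ℝ) (h : Fin s → MvPolynomial (Fin n) ℝ)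
    (p : Fin t → MvPolynomial (Fin n) ℝ) (γ : Fin t → ℝ)
    (σ0 : MvPolynomial (Fin n) ℝ) (σ : Fin r → MvPolynomial (Fin n) ℝ)
    (u : Fin s → MvPolynomial (Fin n) ℝ) (lam : Fin t → ℝ)
    (hσ0 : IsSumSq σ0) (hσ : ∀ j, IsSumSq (σ j)) (hlam : ∀ l, 0 ≤ lam l)
    (hid : σ0 + ∑ j, σ j * g j + ∑ k, u k * h k
        + ∑ l, C (lam l) * (C (γ l) - p l) = -1) :
    ¬ ∃ μ : Measure (Fin n → ℝ), IsProbabilityMeasure μ ∧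
      (∀ᵐ x ∂μ, (∀ j, 0 ≤ eval x (g j)) ∧ (∀ k, eval x (h k) = 0)) ∧
      Integrable (fun x => eval x σ0) μ ∧
      (∀ j, Integrable (fun x => eval x (σ j * g j)) μ) ∧
      (∀ k, Integrable (fun x => eval x (u k * h k)) μ) ∧
      (∀ l, Integrable (fun x => eval x (p l)) μ) ∧
      (∀ l, ∫ x, eval x (p l) ∂μ ≤ γ l) := by
  rintro ⟨μ, hμ, hae, -, -, -, hp, hb⟩
  have sq : ∀ (q : MvPolynomial (Fin n) ℝ) (x : Fin n → ℝ), IsSumSq q → 0 ≤ eval x q := by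
    intro q x hq
    induction hq with
    | zero => simp
    | sq_add a _ ih =>
      rw [map_add, map_mul]
      exact add_nonneg (mul_self_nonneg _) ih
  have hint : ∀ l, Integrable (fun x => lam l * (γ l - eval x (p l))) μ := fun l =>
    ((integrable_const (γ l)).sub (hp l)).const_mul (lam l)
  have h1 : ∀ᵐ x ∂μ, ∑ l, lam l * (γ l - eval x (p l)) ≤ (-1 : ℝ) := by
    filter_upwards [hae] with x hx
    have e := congrArg (eval x) hid
    simp only [map_add, map_sum, map_mul, map_sub, map_neg, map_one, eval_C] at e
    have a1 := sq σ0 x hσ0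
    have a2 : 0 ≤ ∑ j, eval x (σ j) * eval x (g j) :=
      Finset.sum_nonneg fun j _ => mul_nonneg (sq _ x (hσ j)) (hx.1 j)
    have a3 : ∑ k, eval x (u k) * eval x (h k) = 0 :=
      Finset.sum_eq_zero fun k _ => by rw [hx.2 k, mul_zero]
    linarith
  have h2 : ∫ x, ∑ l, lam l * (γ l - eval x (p l)) ∂μ ≤ ∫ _x, (-1 : ℝ) ∂μ :=
    integral_mono_ae (integrable_finsetSum _ fun l _ => hint l) (integrable_const _) h1
  rw [integral_finsetSum _ fun l _ => hint l] at h2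
  have h3 : 0 ≤ ∑ l, ∫ x, lam l * (γ l - eval x (p l)) ∂μ := by
    refine Finset.sum_nonneg fun l _ => ?_
    rw [integral_const_mul, integral_sub (integrable_const _) (hp l)]
    refine mul_nonneg (hlam l) ?_
    have := hb l
    simpa using this
  simp only [integral_const, probReal_univ, smul_eq_mul, one_mul] at h2
  linarith
end

section
/- Let 𝒞 be a set of clauses over propositional variables x_1, …, x_n, encoded as the polynomial system over the 2n variables x_1, …, x_n, x̄_1, …, x̄_n consisting of the equalities x_i² - x_i = 0, x̄_i² - x̄_i = 0, and x_i + x̄_i - 1 = 0 for each i, together with, for each clause C ∈ 𝒞, the inequality Σ_{ℓ ∈ C} ℓ - 1 ≥ 0. If 𝒞 has a unit propagation refutation from the empty partial assignment, then there is no degree-1 pseudo-expectation for this polynomial system, i.e., there is no linear functional L on real polynomials of total degree at most 1 with L(1) = 1, L(ℓ) ≥ 0 for every literal variable ℓ ∈ {x_i, x̄_i}, L(x_i + x̄_i - 1) = 0 for every i, and L(Σ_{ℓ ∈ C} ℓ - 1) ≥ 0 for every clause C ∈ 𝒞. -/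
open MvPolynomial

/-- A literal over `n` propositional variables. -/
abbrev Lit (n : ℕ) := Fin n × Bool

/-- A clause is a finite set of literals. -/
abbrev Clause (n : ℕ) := Finset (Lit n)

/-- A partial assignment `ρ ∈ {0,1,*}^n`: `none` means unassigned. -/
abbrev PAssign (n : ℕ) := Fin n → Option Bool

/-- The literal `l` is falsified by the partial assignment `ρ`. -/
def litFalsified {n : ℕ} (ρ : PAssign n) (l : Lit n) : Prop := ρ l.1 = some (!l.2)

/-- Extend a partial assignment with `x_i = b`. -/
def extendPA {n : ℕ} (ρ : PAssign n) (i : Fin n) (b : Bool) : PAssign n :=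
  fun j => if j = i then some b else ρ j

/-- The clause `C` simplifies to the single literal `l` under `ρ`. -/
def isUnitClause {n : ℕ} (ρ : PAssign n) (C : Clause n) (l : Lit n) : Prop :=
  l ∈ C ∧ ρ l.1 = none ∧ ∀ l' ∈ C, l' ≠ l → litFalsified ρ l'

/-- Unit propagation refutations of `𝒞` from a partial assignment `ρ`:
either some clause of `𝒞` is falsified by `ρ`, or some clause simplifies to a unit
literal which may be asserted and propagation continued. -/
inductive UPRefutes {n : ℕ} (𝒞 : Set (Clause n)) : PAssign n → Prop
  | emptyClause {ρ : PAssign n} {C : Clause n} (hC : C ∈ 𝒞)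
      (h : ∀ l ∈ C, litFalsified ρ l) : UPRefutes 𝒞 ρ
  | unitProp {ρ : PAssign n} {C : Clause n} {l : Lit n} (hC : C ∈ 𝒞)
      (h : isUnitClause ρ C l) (h' : UPRefutes 𝒞 (extendPA ρ l.1 l.2)) :
      UPRefutes 𝒞 ρ

/-- The polynomial variable (among the `2n` variables `x_1,…,x_n,x̄_1,…,x̄_n`,
encoded as `Fin n ⊕ Fin n`) corresponding to a literal. -/
noncomputable def litPoly {n : ℕ} (l : Lit n) : MvPolynomial (Fin n ⊕ Fin n) ℝ :=
  if l.2 then X (Sum.inl l.1) else X (Sum.inr l.1)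

/-- The linear inequality encoding `Σ_{ℓ ∈ C} ℓ - 1 ≥ 0` of a clause `C`. -/
noncomputable def clausePoly {n : ℕ} (C : Clause n) : MvPolynomial (Fin n ⊕ Fin n) ℝ :=
  (∑ l ∈ C, litPoly l) - 1

theorem upRefutes_aux {n : ℕ} (𝒞 : Set (Clause n))
    (L : MvPolynomial (Fin n ⊕ Fin n) ℝ →ₗ[ℝ] ℝ) (h1 : L 1 = 1)
    (h0 : ∀ l : Lit n, 0 ≤ L (litPoly l))
    (hs : ∀ (i : Fin n) (b : Bool), L (litPoly (i, b)) + L (litPoly (i, !b)) = 1)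
    (hc : ∀ C ∈ 𝒞, 0 ≤ L (clausePoly C)) (ρ : PAssign n) (href : UPRefutes 𝒞 ρ) :
    (∀ l, litFalsified ρ l → L (litPoly l) = 0) → False := by
  induction href with
  | @emptyClause ρ C hC h =>
    intro hρ
    have h2 := hc C hC
    rw [clausePoly, map_sub, map_sum, h1,
      Finset.sum_eq_zero (fun l hl => hρ l (h l hl))] at h2
    linarith
  | @unitProp ρ C l hC h h' ih =>
    intro hρ
    apply ih
    have h2 := hc C hC
    rw [clausePoly, map_sub, map_sum, h1,
      Finset.sum_eq_single_of_mem l h.1 (fun l' hl' hne => hρ l' (h.2.2 l' hl' hne))] at h2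
    rintro ⟨j, b⟩ hj
    by_cases hji : j = l.1
    · subst hji
      have hb : l.2 = !b := by simpa [litFalsified, extendPA] using hj
      have h3 := hs l.1 b
      rw [← hb] at h3
      have h4 := h0 (l.1, b)
      have h5 : L (litPoly (l.1, l.2)) = L (litPoly l) := rfl
      linarith
    · apply hρ
      simpa [litFalsified, extendPA, hji] using hj

/-- **Degree-1 sum-of-squares detects unit propagation refutations.**
If `𝒞` has a unit propagation refutation from the empty partial assignment, then
there is no linear functional `L` on polynomials with `L(1) = 1`, `L(ℓ) ≥ 0` for
every literal variable `ℓ`, `L(x_i + x̄_i - 1) = 0` for every `i`, and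
`L(Σ_{ℓ ∈ C} ℓ - 1) ≥ 0` for every clause `C ∈ 𝒞`. -/
theorem stmt_15 {n : ℕ} (𝒞 : Set (Clause n))
    (href : UPRefutes 𝒞 (fun _ => none)) :
    ¬ ∃ L : MvPolynomial (Fin n ⊕ Fin n) ℝ →ₗ[ℝ] ℝ,
      L 1 = 1 ∧
      (∀ v : Fin n ⊕ Fin n, 0 ≤ L (X v)) ∧
      (∀ i : Fin n, L (X (Sum.inl i) + X (Sum.inr i) - 1) = 0) ∧
      (∀ C ∈ 𝒞, 0 ≤ L (clausePoly C)) := by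
  rintro ⟨L, h1, h0, hs, hc⟩
  refine upRefutes_aux 𝒞 L h1 ?_ ?_ hc _ href ?_
  · intro l
    unfold litPoly
    split_ifs <;> exact h0 _
  · intro i b
    have h := hs i
    rw [map_sub, map_add, h1] at h
    cases b <;> simp [litPoly] <;> linarith
  · intro l hl
    simp [litFalsified] at hl
end

section
/- Let d ≥ 2, let L be a linear functional on the space of real polynomials in x_1, …, x_n of total degree at most d such that L(1) = 1 and L(q²) ≥ 0 for every polynomial q with deg(q²) ≤ d. Let ℓ be one of the variables, suppose L satisfies the localizing constraints for the Boolean axiom on ℓ, namely L(ℓ²·p) = L(ℓ·p) for every polynomial p with deg(ℓ²·p) ≤ d, and suppose L(ℓ) > 0. Define L'(p) = L(ℓ·p) / L(ℓ) for polynomials p of total degree at most d - 2. Then L'(1) = 1, L'(q²) ≥ 0 for every polynomial q with deg(q²) ≤ d - 2, and L'(ℓ·p) = L'(p) for every polynomial p with deg(ℓ·p) ≤ d - 2 (in particular L'(ℓ) = 1). -/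
open MvPolynomial

/-- **The conditioning operation on pseudo-expectations.**
Let `d ≥ 2` and let `L` be a linear functional on polynomials with `L(1) = 1` and
`L(q²) ≥ 0` whenever `deg q² ≤ d`. Let `ℓ = x_i` be a variable satisfying the
localizing constraints for its Boolean axiom, `L(ℓ²p) = L(ℓp)` whenever
`deg(ℓ²p) ≤ d`, and suppose `L(ℓ) > 0`. Then `L'(p) := L(ℓp)/L(ℓ)` satisfies
`L'(1) = 1`, `L'(q²) ≥ 0` whenever `deg q² ≤ d - 2`, `L'(ℓp) = L'(p)` whenever
`deg(ℓp) ≤ d - 2`, and in particular `L'(ℓ) = 1`. -/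
theorem stmt_17 (n d : ℕ) (hd : 2 ≤ d) (L : MvPolynomial (Fin n) ℝ →ₗ[ℝ] ℝ)
    (h1 : L 1 = 1)
    (hsq : ∀ q : MvPolynomial (Fin n) ℝ, (q ^ 2).totalDegree ≤ d → 0 ≤ L (q ^ 2))
    (i : Fin n)
    (hbool : ∀ p : MvPolynomial (Fin n) ℝ, (X i ^ 2 * p).totalDegree ≤ d →
      L (X i ^ 2 * p) = L (X i * p))
    (hpos : 0 < L (X i)) :
    L (X i * 1) / L (X i) = 1 ∧
    (∀ q : MvPolynomial (Fin n) ℝ, (q ^ 2).totalDegree ≤ d - 2 →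
      0 ≤ L (X i * q ^ 2) / L (X i)) ∧
    (∀ p : MvPolynomial (Fin n) ℝ, (X i * p).totalDegree ≤ d - 2 →
      L (X i * (X i * p)) / L (X i) = L (X i * p) / L (X i)) ∧
    L (X i * X i) / L (X i) = 1 := by
  have hX2 : (X i ^ 2 : MvPolynomial (Fin n) ℝ).totalDegree ≤ 2 := by
    rw [totalDegree_X_pow]
  have hX1 : (X i : MvPolynomial (Fin n) ℝ).totalDegree ≤ 1 := by
    rw [totalDegree_X]
  refine ⟨?_, ?_, ?_, ?_⟩
  · rw [mul_one, div_self hpos.ne']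
  · intro q hq
    have hdeg : (X i ^ 2 * q ^ 2).totalDegree ≤ d := by
      have := totalDegree_mul (X i ^ 2) (q ^ 2)
      omega
    rw [← hbool _ hdeg]
    have h := hsq (X i * q) (by rw [mul_pow]; exact hdeg)
    rw [mul_pow] at h
    exact div_nonneg h hpos.le
  · intro p hp
    have hdeg : (X i ^ 2 * p).totalDegree ≤ d := by
      have := totalDegree_mul (X i) (X i * p)
      rw [sq, mul_assoc]
      omega
    rw [← hbool _ hdeg, sq, mul_assoc]
  · have h := hbool 1 (by rw [mul_one]; omega)
    rw [mul_one, mul_one, sq] at h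
    rw [h, div_self hpos.ne']
end
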